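/- Let G and H be loopless weakly connected digraphs, α, β : G → H homomorphisms, q₀ ∈ V(G), and let (W_v)_{v ∈ V(G)} be a system of walks from q₀ to each vertex of G of length at most |V(G)|. Then there is a vertex q ∈ V(G) such that the set of orientation-compatible walks for q and the system (W_q⁻¹ W_v)_{v ∈ V(G)} is one of the following: (1) the empty set; (2) a single reduced walk {Q} of even length at most 2|V(G)|; (3) the set of all reduced walks of even length from α(q) to β(q) that satisfy the zigzag condition for q. -/

import Mathlib

namespace HRecoloring

/-- A digraph: a vertex type together with an arc relation. -/
structure Dgraph (V : Type) where
  Adj : V → V → Prop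

variable {V X : Type}

/-- Adjacency in the underlying undirected graph. -/
def Dgraph.UAdj (G : Dgraph V) (u v : V) : Prop := G.Adj u v ∨ G.Adj v u

/-- A digraph is loopless if it has no arc `v → v`. -/
def Dgraph.Loopless (G : Dgraph V) : Prop := ∀ v, ¬ G.Adj v v

/-- A digraph is reflexive if `v → v` for every vertex `v`. -/
def Dgraph.IsReflexive (G : Dgraph V) : Prop := ∀ v, G.Adj v v

/-- A symmetric digraph, which we identify with an undirected graph. -/
def Dgraph.IsSymmetric (G : Dgraph V) : Prop := ∀ u v, G.Adj u v → G.Adj v u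

/-- The underlying undirected graph, as a symmetric digraph. -/
def Dgraph.usym (G : Dgraph V) : Dgraph V := ⟨fun u v => G.UAdj u v⟩

/-- A (di)graph homomorphism. -/
def IsHom (G : Dgraph V) (H : Dgraph X) (f : V → X) : Prop :=
  ∀ ⦃u v⦄, G.Adj u v → H.Adj (f u) (f v)

/-- A walk from `a` to `b`, encoded by its list of successive vertices.
A walk in a digraph is a walk in its underlying undirected graph. -/
def IsWalk (G : Dgraph V) (a b : V) (l : List V) : Prop :=
  l ≠ [] ∧ l.head? = some a ∧ l.getLast? = some b ∧ l.Chain' G.UAdj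

/-- Weak connectivity. -/
def Dgraph.WConn (G : Dgraph V) : Prop := ∀ u v : V, ∃ l, IsWalk G u v l

/-- Concatenation of two walks sharing an endpoint. -/
def wcomp (l₁ l₂ : List V) : List V := l₁ ++ l₂.tail

/-- Number of edges of a walk. -/
def wlen (l : List V) : ℕ := l.length - 1

/-- One reduction step on walks: delete a backtracking pair `(x y)(y x)` or a
one-edge loop step `(x x)`. -/
def RStep (l l' : List V) : Prop :=
  (∃ (p s : List V) (x y : V), l = p ++ [x, y, x] ++ s ∧ l' = p ++ [x] ++ s) ∨
  (∃ (p s : List V) (x : V), l = p ++ [x, x] ++ s ∧ l' = p ++ [x] ++ s)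

/-- Equality of walks in the fundamental groupoid `π(H)`: the equivalence
generated by reduction steps (two walks are equal in `π(H)` iff they reduce to
the same reduced walk). -/
def PiEq (l l' : List V) : Prop := Relation.EqvGen RStep l l'

/-- A walk is reduced if no reduction step applies to it. -/
def IsReduced (l : List V) : Prop := ∀ l', ¬ RStep l l'

/-- A closed walk is cyclically reduced if it is reduced and its first and last
edges are not inverses of each other. -/
def IsCycReduced (l : List V) : Prop :=
  IsReduced l ∧ ∃ h : 2 ≤ l.length,
    l.get ⟨1, by omega⟩ ≠ l.get ⟨l.length - 2, by omega⟩

/-- `n`-fold concatenation of a closed walk `R` based at `h`. -/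
def witer (R : List V) (h : V) : ℕ → List V
  | 0 => [h]
  | n + 1 => wcomp R (witer R h n)

/-- `Rⁿ` for an integer `n`, for a closed walk `R` based at `h`; for `n < 0`
this is the `|n|`-fold concatenation of the reversed walk `R⁻¹`. -/
def zpowWalk (R : List V) (h : V) (n : ℤ) : List V :=
  if 0 ≤ n then witer R h n.toNat else witer R.reverse h (-n).toNat

/-- A walk is symmetric if every edge it traverses is a symmetric arc. -/
def IsSymWalk (H : Dgraph X) (l : List X) : Prop :=
  l.Chain' fun a b => H.Adj a b ∧ H.Adj b a

/-- The conjugated walk `α(W)⁻¹ · Q · β(W)`. -/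
def conj (α β : V → X) (Wl : List V) (Q : List X) : List X :=
  wcomp (wcomp (Wl.map α).reverse Q) (Wl.map β)

/-- Topological validity of a walk `Q` from `α q` to `β q`:
`β(C) = Q⁻¹ · α(C) · Q` in `π(H)` for every closed walk `C` at `q`. -/
def TopValid (G : Dgraph V) (H : Dgraph X) (α β : V → X) (q : V) (Q : List X) : Prop :=
  ∀ C : List V, IsWalk G q q C →
    PiEq (C.map β) (wcomp (wcomp Q.reverse (C.map α)) Q)

/-- IN-zigzag pattern `a₁ ← a₂ → a₃ ← … ← a_{n-1} → a_n`. -/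
def INCompatible (H : Dgraph X) (l : List X) : Prop :=
  ∀ (i : ℕ) (h : i + 1 < l.length),
    if i % 2 = 0 then H.Adj (l.get ⟨i + 1, h⟩) (l.get ⟨i, by omega⟩)
    else H.Adj (l.get ⟨i, by omega⟩) (l.get ⟨i + 1, h⟩)

/-- OUT-zigzag pattern `a₁ → a₂ ← a₃ → … → a_{n-1} ← a_n`. -/
def OUTCompatible (H : Dgraph X) (l : List X) : Prop :=
  ∀ (i : ℕ) (h : i + 1 < l.length),
    if i % 2 = 0 then H.Adj (l.get ⟨i, by omega⟩) (l.get ⟨i + 1, h⟩)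
    else H.Adj (l.get ⟨i + 1, h⟩) (l.get ⟨i, by omega⟩)

/-- A vertex is of type IN if it has an in-neighbor. -/
def TypeIN (G : Dgraph V) (v : V) : Prop := ∃ u, G.Adj u v

/-- A vertex is of type OUT if it has an out-neighbor. -/
def TypeOUT (G : Dgraph V) (v : V) : Prop := ∃ u, G.Adj v u

/-- A vertex is of type SYM if it is of type IN and of type OUT. -/
def TypeSYM (G : Dgraph V) (v : V) : Prop := TypeIN G v ∧ TypeOUT G v

/-- The zigzag condition for the vertex `v`. -/
def Zigzag (G : Dgraph V) (H : Dgraph X) (v : V) (l : List X) : Prop :=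
  (TypeIN G v → INCompatible H l) ∧ (TypeOUT G v → OUTCompatible H l)

/-- A recoloring sequence: a nonempty sequence of homomorphisms in which
consecutive homomorphisms differ on exactly one vertex. -/
def IsRecolSeq (G : Dgraph V) (H : Dgraph X) (σs : List (V → X)) : Prop :=
  σs ≠ [] ∧ (∀ σ ∈ σs, IsHom G H σ) ∧ σs.Chain' fun σ σ' => ∃! u, σ u ≠ σ' u

/-- The monochromatic neighborhood property: whenever a vertex changes its
color, all of its neighbors (in the underlying undirected graph) have one
common color. -/
def MonoNbhd (G : Dgraph V) (σs : List (V → X)) : Prop :=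
  σs.Chain' fun σ σ' => ∀ v, σ v ≠ σ' v → ∃ h, ∀ w, G.UAdj v w → σ w = h

/-- `VWalk G v σs S`: `S` is the vertex walk `S(v)` of the recoloring sequence
`σs`; each color change of `v` from `a` to `b`, while all neighbors of `v` are
colored `h`, contributes the two edges `(a h)(h b)`. -/
inductive VWalk (G : Dgraph V) (v : V) : List (V → X) → List X → Prop
  | single (σ : V → X) : VWalk G v [σ] [σ v]
  | stay {σ σ' : V → X} {rest : List (V → X)} {l : List X} :
      σ v = σ' v → VWalk G v (σ' :: rest) l → VWalk G v (σ :: σ' :: rest) l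
  | move {σ σ' : V → X} {rest : List (V → X)} {l : List X} (h : X) :
      σ v ≠ σ' v → (∀ w, G.UAdj v w → σ w = h) →
      VWalk G v (σ' :: rest) l → VWalk G v (σ :: σ' :: rest) (σ v :: h :: l)

/-- `H`-realizability of a walk `Q` via recoloring sequences satisfying the
monochromatic neighborhood property: `Q = S(q)` in `π(H)`. -/
def MRealizable (G : Dgraph V) (H : Dgraph X) (α β : V → X) (q : V) (Q : List X) : Prop :=
  ∃ (σs : List (V → X)) (Sq : List X),
    IsRecolSeq G H σs ∧ σs.head? = some α ∧ σs.getLast? = some β ∧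
    MonoNbhd G σs ∧ VWalk G q σs Sq ∧ PiEq Sq Q

/-- Orientation compatibility of a walk `Q`: every generated vertex walk
satisfies the zigzag condition. -/
def OrientCompatible (G : Dgraph V) (H : Dgraph X) (α β : V → X) (q : V) (Q : List X) : Prop :=
  ∀ (v : V) (Wl : List V), IsWalk G q v Wl →
    ∀ S : List X, IsReduced S → PiEq (conj α β Wl Q) S → Zigzag G H v S

/-- Hom₁-adjacency: the homomorphisms differ on exactly one vertex and, for
every arc `x → y` of `G`, both `φ x → ψ y` and `ψ x → φ y` are arcs of `H`. -/
def Hom1Adj (G : Dgraph V) (H : Dgraph X) (φ ψ : V → X) : Prop :=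
  (∃! u, φ u ≠ ψ u) ∧ ∀ ⦃x y⦄, G.Adj x y → H.Adj (φ x) (ψ y) ∧ H.Adj (ψ x) (φ y)

/-- A recoloring sequence in the Hom₁ sense (digraphs). -/
def Hom1Seq (G : Dgraph V) (H : Dgraph X) (σs : List (V → X)) : Prop :=
  σs ≠ [] ∧ (∀ σ ∈ σs, IsHom G H σ) ∧ σs.Chain' (Hom1Adj G H)

/-- A recoloring sequence in which each step recolors exactly one vertex to an
adjacent color (the Hom₁ sense for reflexive undirected graphs). -/
def AdjRecolSeq (G : Dgraph V) (H : Dgraph X) (σs : List (V → X)) : Prop :=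
  σs ≠ [] ∧ (∀ σ ∈ σs, IsHom G H σ) ∧
  σs.Chain' fun σ σ' => (∃! u, σ u ≠ σ' u) ∧ ∀ u, σ u ≠ σ' u → H.Adj (σ u) (σ' u)

/-- The push-or-pull property: whenever a vertex changes its color from `a` to
`b`, every neighbor of that vertex has color `a` or `b`. -/
def PushOrPull (G : Dgraph V) (σs : List (V → X)) : Prop :=
  σs.Chain' fun σ σ' => ∀ u, σ u ≠ σ' u → ∀ w, G.UAdj u w → σ w = σ u ∨ σ w = σ' u

/-- The walk of successive colors of `v` along a recoloring sequence. -/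
def colorWalk (σs : List (V → X)) (v : V) : List X := σs.map fun σ => σ v

/-- `H`-realizability via recoloring sequences (reflexive undirected Hom₁
sense) satisfying the push-or-pull property. -/
def PRealizable (G : Dgraph V) (H : Dgraph X) (α β : V → X) (q : V) (Q : List X) : Prop :=
  ∃ σs : List (V → X), AdjRecolSeq G H σs ∧ σs.head? = some α ∧ σs.getLast? = some β ∧
    PushOrPull G σs ∧ PiEq (colorWalk σs q) Q

/-- `H`-realizability via Hom₁ recoloring sequences of digraphs satisfying the
push-or-pull property. -/
def DRealizable (G : Dgraph V) (H : Dgraph X) (α β : V → X) (q : V) (Q : List X) : Prop :=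
  ∃ σs : List (V → X), Hom1Seq G H σs ∧ σs.head? = some α ∧ σs.getLast? = some β ∧
    PushOrPull G σs ∧ PiEq (colorWalk σs q) Q

/-- `H` contains no 4-cycle of algebraic girth 0 as a subgraph (neither of the
two orientations of the 4-cycle with two forward and two backward arcs). -/
def NoZeroGirthC4 (H : Dgraph X) : Prop :=
  ∀ a b c d : X, a ≠ b → a ≠ c → a ≠ d → b ≠ c → b ≠ d → c ≠ d →
    ¬(H.Adj a b ∧ H.Adj b d ∧ H.Adj a c ∧ H.Adj c d) ∧
    ¬(H.Adj a b ∧ H.Adj d b ∧ H.Adj a c ∧ H.Adj d c)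

/-- `H` contains no triangle of algebraic girth 1 as a subgraph. -/
def NoOneGirthTriangle (H : Dgraph X) : Prop :=
  ∀ x y z : X, x ≠ y → y ≠ z → x ≠ z → ¬(H.Adj x y ∧ H.Adj y z ∧ H.Adj x z)

/-- A path in the reconfiguration graph `R_H(G)` from `α` to `β`. -/
def IsRPath (G : Dgraph V) (H : Dgraph X) (α β : V → X) (L : List (V → X)) : Prop :=
  L ≠ [] ∧ L.head? = some α ∧ L.getLast? = some β ∧
  (∀ σ ∈ L, IsHom G H σ) ∧ L.Chain' fun φ ψ => ∃! u, φ u ≠ ψ u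

/-- A path in the graph `Hom₁(G, H)` from `α` to `β`. -/
def IsHom1Path (G : Dgraph V) (H : Dgraph X) (α β : V → X) (L : List (V → X)) : Prop :=
  L ≠ [] ∧ L.head? = some α ∧ L.getLast? = some β ∧
  (∀ σ ∈ L, IsHom G H σ) ∧ L.Chain' (Hom1Adj G H)

/-- The set of reduced walks `Q` from `α q` to `β q` that generate symmetric
vertex walks on `V'` with the system of walks `Wf`. -/
def SymGenSet (H : Dgraph X) (α β : V → X) (q : V)
    (V' : Set V) (Wf : V → List V) : Set (List X) :=
  {Q | IsWalk H (α q) (β q) Q ∧ IsReduced Q ∧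
    ∀ v ∈ V', ∀ S : List X, IsReduced S → PiEq (conj α β (Wf v) Q) S → IsSymWalk H S}

/-- The set of orientation-compatible walks for `q` and the system `Uf`. -/
def OCSet (G : Dgraph V) (H : Dgraph X) (α β : V → X) (q : V)
    (Uf : V → List V) : Set (List X) :=
  {Q | IsWalk H (α q) (β q) Q ∧ IsReduced Q ∧ Even (wlen Q) ∧
    ∀ (v : V) (S : List X), IsReduced S → PiEq (conj α β (Uf v) Q) S → Zigzag G H v S}

/-- The set `Π_q` of walks from `α q` to `β q` that are `H`-realizable via
recoloring sequences satisfying the monochromatic neighborhood property. -/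
def MRealSet (G : Dgraph V) (H : Dgraph X) (α β : V → X) (q : V) : Set (List X) :=
  {Q | IsWalk H (α q) (β q) Q ∧ IsReduced Q ∧ MRealizable G H α β q Q}

/-- The set of walks from `α q` to `β q` that are `H`-realizable via
recoloring sequences satisfying the push-or-pull property. -/
def PRealSet (G : Dgraph V) (H : Dgraph X) (α β : V → X) (q : V) : Set (List X) :=
  {Q | IsWalk H (α q) (β q) Q ∧ IsReduced Q ∧ PRealizable G H α β q Q}

/-- Ceiling division on natural numbers. -/
def cdiv (a b : ℕ) : ℕ := (a + b - 1) / b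

end HRecoloring

open HRecoloring

namespace HRecoloring

section Reduction

variable {X : Type}

/-- Local form of reducedness: no loop step and no backtracking at any position. -/
def Red : List X → Prop
  | x :: y :: t => x ≠ y ∧ t.head? ≠ some x ∧ Red (y :: t)
  | _ => True

theorem RStep.append {l l' : List X} (h : RStep l l') (p s : List X) :
    RStep (p ++ l ++ s) (p ++ l' ++ s) := by
  rcases h with ⟨p', s', x, y, rfl, rfl⟩ | ⟨p', s', x, rfl, rfl⟩
  · exact Or.inl ⟨p ++ p', s' ++ s, x, y, by simp, by simp⟩
  · exact Or.inr ⟨p ++ p', s' ++ s, x, by simp, by simp⟩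

theorem IsReduced.red {l : List X} (h : IsReduced l) : Red l := by
  induction l with
  | nil => trivial
  | cons x l ih =>
    have hl : IsReduced l := fun l' hs => h (x :: l') (by simpa using hs.append [x] [])
    match l, ih hl, h with
    | [], _, _ => trivial
    | y :: t, ht, h =>
      refine ⟨?_, ?_, ht⟩
      · rintro rfl
        exact h _ (Or.inr ⟨[], t, x, by simp, rfl⟩)
      · intro hh
        obtain ⟨t', rfl⟩ : ∃ t', t = x :: t' := by
          cases t <;> simp_all
        exact h _ (Or.inl ⟨[], t', x, y, by simp, rfl⟩)

theorem Red.of_cons {x : X} {l : List X} (h : Red (x :: l)) : Red l := by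
  cases l with
  | nil => trivial
  | cons y t => exact h.2.2

theorem Red.of_append {p s : List X} (h : Red (p ++ s)) : Red s := by
  induction p with
  | nil => exact h
  | cons x p ih => exact ih (Red.of_cons h)

theorem Red.isReduced {l : List X} (h : Red l) : IsReduced l := by
  rintro l' (⟨p, s, x, y, rfl, -⟩ | ⟨p, s, x, rfl, -⟩)
  · rw [List.append_assoc] at h
    exact h.of_append.2.1 rfl
  · rw [List.append_assoc] at h
    exact h.of_append.1 rfl

theorem Red.append {p t : List X} {m z : X} (hp : Red (p ++ [m])) (ht : Red (m :: z :: t))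
    (hz : p.getLast? ≠ some z) : Red (p ++ m :: z :: t) := by
  induction p with
  | nil => exact ht
  | cons x p ih =>
    match p, ih, hp, hz with
    | [], _, hp, hz => exact ⟨hp.1, by simpa [eq_comm] using hz, ht⟩
    | [y], ih, hp, hz => exact ⟨hp.1, hp.2.1, ih hp.2.2 (by simpa using hz)⟩
    | y :: w :: p, ih, hp, hz => exact ⟨hp.1, hp.2.1, ih hp.2.2 (by simpa using hz)⟩

theorem IsReduced.reverse {l : List X} (h : IsReduced l) : IsReduced l.reverse := by
  rintro l' (⟨p, s, x, y, hl, -⟩ | ⟨p, s, x, hl, -⟩)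
  · exact h _ (Or.inl ⟨s.reverse, p.reverse, x, y, by
      rw [← List.reverse_reverse l, hl]; simp, rfl⟩)
  · exact h _ (Or.inr ⟨s.reverse, p.reverse, x, by
      rw [← List.reverse_reverse l, hl]; simp, rfl⟩)

theorem IsReduced.of_append_right {p s : List X} (h : IsReduced (p ++ s)) : IsReduced s :=
  fun l' hl => h (p ++ l') (by simpa using hl.append p [])

open Classical in
/-- Prepend a vertex to a reduced walk and reduce. -/
noncomputable def push (x : X) : List X → List X
  | [] => [x]
  | y :: t => if x = y then y :: t else if t.head? = some x then t else x :: y :: t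

/-- The reduced form of a walk. -/
noncomputable def reduce (l : List X) : List X := l.foldr push []

theorem push_eq_cons (x : X) (l : List X) : ∃ t, push x l = x :: t := by
  cases l with
  | nil => exact ⟨[], rfl⟩
  | cons y t =>
    simp only [push]
    split_ifs with h1 h2
    · exact ⟨t, by rw [h1]⟩
    · cases t <;> simp_all
    · exact ⟨_, rfl⟩

theorem red_push {x : X} {l : List X} (h : Red l) : Red (push x l) := by
  cases l with
  | nil => trivial
  | cons y t =>
    simp only [push]
    split_ifs with h1 h2
    · exact h
    · exact h.of_cons
    · exact ⟨h1, h2, h⟩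

theorem push_push_self (x : X) (l : List X) : push x (push x l) = push x l := by
  obtain ⟨t, ht⟩ := push_eq_cons x l
  rw [ht]
  simp [push]

theorem push_push_push {x y : X} {l : List X} (h : Red l) :
    push x (push y (push x l)) = push x l := by
  obtain ⟨t, ht⟩ := push_eq_cons x l
  have hr : Red (x :: t) := ht ▸ red_push h
  rw [ht]
  by_cases hyx : y = x
  · subst hyx; simp [push]
  · by_cases hty : t.head? = some y
    · obtain ⟨t', rfl⟩ : ∃ t', t = y :: t' := by cases t <;> simp_all
      have := hr.2.1
      simp [push, hyx, Ne.symm hyx, this]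
    · simp [push, hyx, hty, Ne.symm hyx]

theorem red_reduce (l : List X) : Red (reduce l) := by
  induction l with
  | nil => trivial
  | cons x l ih => exact red_push ih

theorem isReduced_reduce (l : List X) : IsReduced (reduce l) := (red_reduce l).isReduced

theorem Red.reduce_eq {l : List X} (h : Red l) : reduce l = l := by
  induction l with
  | nil => rfl
  | cons x l ih =>
    have := ih h.of_cons
    change push x (reduce l) = _
    rw [this]
    cases l with
    | nil => rfl
    | cons y t => simp [push, h.1, h.2.1]

theorem reduce_append (p s : List X) : reduce (p ++ s) = p.foldr push (reduce s) := by
  simp [reduce]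

theorem RStep.reduce_eq {l l' : List X} (h : RStep l l') : reduce l = reduce l' := by
  rcases h with ⟨p, s, x, y, rfl, rfl⟩ | ⟨p, s, x, rfl, rfl⟩
  · rw [List.append_assoc, List.append_assoc, reduce_append, reduce_append p]
    exact congrArg (fun r => List.foldr push r p) (push_push_push (red_reduce s))
  · rw [List.append_assoc, List.append_assoc, reduce_append, reduce_append p]
    exact congrArg (fun r => List.foldr push r p) (push_push_self x _)

theorem PiEq.reduce_eq {l l' : List X} (h : PiEq l l') : reduce l = reduce l' := by
  induction h with
  | rel _ _ h => exact h.reduce_eq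
  | refl => rfl
  | symm _ _ _ ih => exact ih.symm
  | trans _ _ _ _ _ ih₁ ih₂ => exact ih₁.trans ih₂

theorem reflTransGen_reduce (l : List X) : Relation.ReflTransGen RStep l (reduce l) := by
  induction l with
  | nil => exact .refl
  | cons x l ih =>
    have h1 : Relation.ReflTransGen RStep (x :: l) (x :: reduce l) :=
      ih.lift (x :: ·) fun a b hab => by simpa using hab.append [x] []
    refine h1.trans ?_
    change Relation.ReflTransGen RStep _ (push x (reduce l))
    generalize reduce l = r
    cases r with
    | nil => exact .refl
    | cons y t =>
      simp only [push]
      split_ifs with h1 h2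
      · subst h1
        exact .single (Or.inr ⟨[], t, x, by simp, rfl⟩)
      · obtain ⟨t', rfl⟩ : ∃ t', t = x :: t' := by cases t <;> simp_all
        exact .single (Or.inl ⟨[], t', x, y, by simp, rfl⟩)
      · exact .refl

@[refl] theorem PiEq.refl (l : List X) : PiEq l l := Relation.EqvGen.refl l

@[symm] theorem PiEq.symm {l l' : List X} (h : PiEq l l') : PiEq l' l :=
  Relation.EqvGen.symm _ _ h

@[trans] theorem PiEq.trans {l l' l'' : List X} (h : PiEq l l') (h' : PiEq l' l'') : PiEq l l'' :=
  Relation.EqvGen.trans _ _ _ h h'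

theorem piEq_reduce (l : List X) : PiEq l (reduce l) :=
  Relation.EqvGen.reflTransGen_le_eqvGen RStep _ _ (reflTransGen_reduce l)

theorem PiEq.eq_reduce {l S : List X} (h : PiEq l S) (hS : IsReduced S) : S = reduce l := by
  rw [h.reduce_eq, hS.red.reduce_eq]

theorem PiEq.append_both {l l' : List X} (h : PiEq l l') (p s : List X) :
    PiEq (p ++ l ++ s) (p ++ l' ++ s) := by
  induction h with
  | rel _ _ h => exact .rel _ _ (h.append p s)
  | refl => rfl
  | symm _ _ _ ih => exact ih.symm
  | trans _ _ _ _ _ ih₁ ih₂ => exact ih₁.trans ih₂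

theorem PiEq.append {l l' r r' : List X} (h : PiEq l l') (h' : PiEq r r') :
    PiEq (l ++ r) (l' ++ r') := by
  have h1 := h.append_both [] r
  have h2 := h'.append_both l' []
  simp only [List.nil_append, List.append_nil] at h1 h2
  exact h1.trans h2

theorem PiEq.reverse {l l' : List X} (h : PiEq l l') : PiEq l.reverse l'.reverse := by
  induction h with
  | rel _ _ h =>
    refine .rel _ _ ?_
    rcases h with ⟨p, s, x, y, rfl, rfl⟩ | ⟨p, s, x, rfl, rfl⟩
    · exact Or.inl ⟨s.reverse, p.reverse, x, y, by simp, by simp⟩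
    · exact Or.inr ⟨s.reverse, p.reverse, x, by simp, by simp⟩
  | refl => rfl
  | symm _ _ _ ih => exact ih.symm
  | trans _ _ _ _ _ ih₁ ih₂ => exact ih₁.trans ih₂

theorem piEq_loop (x : X) (p s : List X) : PiEq (p ++ x :: x :: s) (p ++ x :: s) :=
  .rel _ _ (Or.inr ⟨p, s, x, by simp, by simp⟩)

/-- In `π(H)`, composition of walks is plain concatenation of vertex lists. -/
theorem piEq_wcomp {l r : List X} (h : l.getLast? = r.head?) : PiEq (wcomp l r) (l ++ r) := by
  cases r with
  | nil => simp [wcomp, PiEq.refl]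
  | cons x r =>
    obtain ⟨p, rfl⟩ : ∃ p, l = p ++ [x] := List.getLast?_eq_some_iff.1 (by simpa using h)
    simpa [wcomp] using (piEq_loop x p r).symm

theorem piEq_append_reverse (x : X) (t : List X) :
    PiEq ((x :: t) ++ (x :: t).reverse) [x] := by
  induction t generalizing x with
  | nil => exact piEq_loop x [] []
  | cons y t ih =>
    have h := (ih y).append_both [x] [x]
    refine PiEq.trans (by simpa using h) ?_
    exact .rel _ _ (Or.inl ⟨[], [], x, y, rfl, rfl⟩)

theorem piEq_cancel_left {l s : List X} (h : l.head? = s.head?) :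
    PiEq (l ++ (l.reverse ++ s)) s := by
  cases l with
  | nil => rfl
  | cons x t =>
    obtain ⟨s, rfl⟩ : ∃ s', s = x :: s' := by cases s <;> simp_all
    have h := (piEq_append_reverse x t).append (PiEq.refl (x :: s))
    rw [List.append_assoc] at h
    exact h.trans (piEq_loop x [] s)

theorem piEq_cancel_right {l s : List X} (h : s.getLast? = l.head?) :
    PiEq (s ++ (l ++ l.reverse)) s := by
  have := (piEq_cancel_left (l := l) (s := s.reverse) (by simp [h])).reverse
  simpa using this

end Reduction

section Invariants

variable {X : Type}

theorem RStep.head? {l l' : List X} (h : RStep l l') : l'.head? = l.head? := by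
  rcases h with ⟨p, s, x, y, rfl, rfl⟩ | ⟨p, s, x, rfl, rfl⟩ <;> cases p <;> simp

theorem RStep.getLast? {l l' : List X} (h : RStep l l') : l'.getLast? = l.getLast? := by
  rcases h with ⟨p, s, x, y, rfl, rfl⟩ | ⟨p, s, x, rfl, rfl⟩ <;>
    simp [List.getLast?_append, List.getLast?_cons]

theorem RStep.length_le {l l' : List X} (h : RStep l l') : l'.length ≤ l.length := by
  rcases h with ⟨p, s, x, y, rfl, rfl⟩ | ⟨p, s, x, rfl, rfl⟩ <;> simp

theorem reduce_induction {P : List X → Prop} (hP : ∀ l l', RStep l l' → P l → P l')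
    {l : List X} (h : P l) : P (reduce l) := by
  have := reflTransGen_reduce l
  generalize reduce l = r at this
  induction this with
  | refl => exact h
  | tail _ hs ih => exact hP _ _ hs ih

theorem head?_reduce (l : List X) : (reduce l).head? = l.head? :=
  reduce_induction (P := fun r => r.head? = l.head?) (fun _ _ h h' => h.head?.trans h') rfl

theorem getLast?_reduce (l : List X) : (reduce l).getLast? = l.getLast? :=
  reduce_induction (P := fun r => r.getLast? = l.getLast?) (fun _ _ h h' => h.getLast?.trans h') rfl

theorem length_reduce_le (l : List X) : (reduce l).length ≤ l.length :=
  reduce_induction (P := fun r => r.length ≤ l.length) (fun _ _ h h' => h.length_le.trans h') le_rfl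

/-- The alternating pattern `R a₁ a₂`, `R a₃ a₂`, `R a₃ a₄`, … along a list. -/
def Alt : (X → X → Prop) → List X → Prop
  | R, x :: y :: t => R x y ∧ Alt (flip R) (y :: t)
  | _, _ => True

theorem flip_iterate_eq (R : X → X → Prop) (n : ℕ) :
    flip^[n] R = if n % 2 = 0 then R else flip R := by
  induction n generalizing R with
  | zero => rfl
  | succ n ih =>
    rw [Function.iterate_succ_apply, ih]
    rcases Nat.mod_two_eq_zero_or_one n with h | h
    · simp [h, Nat.add_mod]
    · simp [h, Nat.add_mod]

theorem alt_append {R : X → X → Prop} {p s : List X} {m : X} :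
    Alt R (p ++ m :: s) ↔ Alt R (p ++ [m]) ∧ Alt (flip^[p.length] R) (m :: s) := by
  induction p generalizing R with
  | nil => simp [Alt]
  | cons x p ih =>
    cases p with
    | nil => simp [Alt]
    | cons y p =>
      have := ih (R := flip R)
      simp only [List.cons_append, Alt] at this ⊢
      rw [this, and_assoc]
      rfl

theorem Alt.mono {R T : X → X → Prop} (h : ∀ x y, R x y → T x y) {l : List X} (hl : Alt R l) :
    Alt T l := by
  induction l generalizing R T with
  | nil => trivial
  | cons x l ih =>
    cases l with
    | nil => trivial
    | cons y t => exact ⟨h _ _ hl.1, ih (fun a b => h b a) hl.2⟩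

theorem alt_wcomp {R : X → X → Prop} {l r : List X} (hl : Alt R l)
    (hr : Alt (flip^[wlen l] R) r) (h : l.getLast? = r.head?) : Alt R (wcomp l r) := by
  cases r with
  | nil => simpa [wcomp] using hl
  | cons x r =>
    obtain ⟨p, rfl⟩ : ∃ p, l = p ++ [x] := List.getLast?_eq_some_iff.1 (by simpa using h)
    simpa [wcomp] using alt_append.2 ⟨hl, by simpa [wlen] using hr⟩

theorem alt_iff_forall {R : X → X → Prop} {l : List X} :
    Alt R l ↔ ∀ (i : ℕ) (h : i + 1 < l.length),
      if i % 2 = 0 then R l[i] l[i + 1] else R l[i + 1] l[i] := by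
  induction l generalizing R with
  | nil => simp [Alt]
  | cons x l ih =>
    cases l with
    | nil => simp [Alt]
    | cons y t =>
      simp only [Alt, ih]
      constructor
      · rintro ⟨h0, h⟩ (_ | i) hi
        · simpa using h0
        · have := h i (by simpa using hi)
          rcases Nat.mod_two_eq_zero_or_one i with h2 | h2 <;>
            simpa [h2, Nat.add_mod, flip] using this
      · intro h
        refine ⟨by simpa using h 0 (by simp), fun i hi => ?_⟩
        have := h (i + 1) (by simpa using hi)
        rcases Nat.mod_two_eq_zero_or_one i with h2 | h2 <;>
          simpa [h2, Nat.add_mod, flip] using this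

theorem alt_iff_isChain {R : X → X → Prop} (hR : ∀ x y, R x y → R y x) {l : List X} :
    Alt R l ↔ l.IsChain R := by
  have hf : flip R = R := by
    funext x y
    exact propext ⟨hR y x, hR x y⟩
  induction l with
  | nil => simp [Alt]
  | cons x l ih =>
    cases l with
    | nil => simp [Alt]
    | cons y t => rw [List.isChain_cons_cons, Alt, hf]; exact and_congr_right fun _ => ih

theorem flip_iterate_self (R : X → X → Prop) (n : ℕ) (x : X) : (flip^[n] R) x x ↔ R x x := by
  rw [flip_iterate_eq]
  split_ifs <;> rfl

theorem RStep.alt {R : X → X → Prop} (hR : ∀ x, ¬ R x x) {l l' : List X} (h : RStep l l')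
    (hl : Alt R l) : Alt R l' ∧ (l'.length % 2 = l.length % 2) := by
  rcases h with ⟨p, s, x, y, rfl, rfl⟩ | ⟨p, s, x, rfl, rfl⟩
  · simp only [List.append_assoc, List.cons_append, List.nil_append] at hl ⊢
    obtain ⟨h1, h2⟩ := alt_append.1 hl
    exact ⟨alt_append.2 ⟨h1, h2.2.2⟩, by simp; omega⟩
  · simp only [List.append_assoc, List.cons_append, List.nil_append] at hl
    obtain ⟨-, h2⟩ := alt_append.1 hl
    exact absurd ((flip_iterate_self R _ x).1 h2.1) (hR x)

theorem Alt.reduce {R : X → X → Prop} (hR : ∀ x, ¬ R x x) {l : List X} (hl : Alt R l) :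
    Alt R (reduce l) ∧ (reduce l).length % 2 = l.length % 2 :=
  reduce_induction (P := fun r => Alt R r ∧ r.length % 2 = l.length % 2)
    (fun _ _ h h' => ⟨(h.alt hR h'.1).1, (h.alt hR h'.1).2.trans h'.2⟩) ⟨hl, rfl⟩

/-- A subwalk along which `R` holds in both directions can be exchanged inside an alternating
walk. -/
theorem Alt.exchange {R : X → X → Prop} {p Z Z' s : List X}
    (h : Alt R (p ++ Z ++ s)) (hZ : Z ≠ [])
    (hZ' : ∀ n, Alt (flip^[n] R) Z') (hh : Z'.head? = Z.head?) (hl : Z'.getLast? = Z.getLast?)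
    (hlen : Z'.length % 2 = Z.length % 2) : Alt R (p ++ Z' ++ s) := by
  obtain ⟨z, m, rfl⟩ : ∃ z m, Z = z ++ [m] := ⟨_, _, (List.dropLast_append_getLast hZ).symm⟩
  obtain ⟨z', rfl⟩ : ∃ z', Z' = z' ++ [m] := List.getLast?_eq_some_iff.1 (by simpa using hl)
  have h' : Alt R ((p ++ z) ++ m :: s) := by simpa using h
  obtain ⟨h1, h2⟩ := alt_append.1 h'
  have key : Alt R ((p ++ z') ++ m :: s) := by
    refine alt_append.2 ⟨?_, ?_⟩
    · obtain ⟨m₀, t, ht⟩ : ∃ m₀ t, z ++ [m] = m₀ :: t := List.exists_cons_of_ne_nil hZ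
      obtain ⟨t', ht'⟩ : ∃ t', z' ++ [m] = m₀ :: t' := by
        rw [ht] at hh
        cases hz : z' ++ [m] <;> simp_all
      rw [List.append_assoc, ht] at h1
      rw [List.append_assoc, ht']
      exact alt_append.2 ⟨(alt_append.1 h1).1, ht' ▸ hZ' _⟩
    · rw [flip_iterate_eq] at h2 ⊢
      simp only [List.length_append, List.length_singleton] at hlen h2 ⊢
      rwa [show (p.length + z'.length) % 2 = (p.length + z.length) % 2 by omega]
  simpa using key

/-- Split off the longest initial part of a walk along which `R` holds. -/
theorem exists_maximal_initial_walk (R : X → X → Prop) {l : List X} (hl : l ≠ []) :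
    ∃ p m s, l = p ++ m :: s ∧ (p ++ [m]).IsChain R ∧ ∀ x, s.head? = some x → ¬ R m x := by
  induction l with
  | nil => exact absurd rfl hl
  | cons a l ih =>
    cases l with
    | nil => exact ⟨[], a, [], rfl, by simp, by simp⟩
    | cons b t =>
      by_cases hab : R a b
      · obtain ⟨p, m, s, he, hc, hs⟩ := ih (by simp)
        refine ⟨a :: p, m, s, by rw [he]; rfl, ?_, hs⟩
        cases p with
        | nil =>
          obtain ⟨rfl, -⟩ : b = m ∧ t = s := by simpa using he
          simpa using hab
        | cons c p =>
          obtain ⟨rfl, -⟩ : b = c ∧ t = p ++ m :: s := by simpa using he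
          exact List.isChain_cons_cons.2 ⟨hab, hc⟩
      · exact ⟨[], a, b :: t, rfl, by simp, by simpa using hab⟩

end Invariants

section Dichotomy

variable {X : Type} {S : X → X → Prop}

theorem exists_reduced_middle (hS : ∀ x y, S x y → S y x) (hirr : ∀ x, ¬ S x x)
    {A B Q : List X} {m m' : X} (hA : (A ++ [m]).IsChain S) (hB : (B ++ [m']).IsChain S)
    (hQ : Q.IsChain S) (hh : Q.head? = (A ++ [m]).head?) (hl : Q.getLast? = (B ++ [m']).head?) :
    ∃ Z, Red Z ∧ Z.IsChain S ∧ Z.head? = some m ∧ Z.getLast? = some m' ∧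
      Z.length % 2 = (A.length + Q.length + B.length) % 2 ∧
      PiEq ((A ++ [m]).reverse ++ (Q ++ (B ++ [m']))) Z := by
  have hf : flip S = S := funext fun x => funext fun y => propext ⟨hS y x, hS x y⟩
  have hfn : ∀ n, flip^[n] S = S := fun n => by rw [flip_iterate_eq, hf, ite_self]
  have hQ0 : Q ≠ [] := by
    rintro rfl
    cases A <;> simp at hh
  have hA' : ((A ++ [m]).reverse).IsChain S :=
    List.isChain_reverse.2 (hA.imp fun a b => hS a b)
  have h1 : (A ++ [m]).reverse.getLast? = Q.head? := by
    rw [hh, List.getLast?_reverse]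
  have h2 : (wcomp (A ++ [m]).reverse Q).getLast? = (B ++ [m']).head? := by
    rw [← hl]
    obtain ⟨x, t, rfl⟩ := List.exists_cons_of_ne_nil hQ0
    obtain ⟨p, hp⟩ := List.getLast?_eq_some_iff.1 (h1.trans List.head?_cons)
    simp [hp, wcomp, List.getLast?_append, List.getLast?_cons]
  have hc : Alt S (wcomp (wcomp (A ++ [m]).reverse Q) (B ++ [m'])) := by
    refine alt_wcomp (alt_wcomp ((alt_iff_isChain hS).2 hA') ?_ h1) ?_ h2
    · rw [hfn]; exact (alt_iff_isChain hS).2 hQ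
    · rw [hfn]; exact (alt_iff_isChain hS).2 hB
  have hr := hc.reduce hirr
  refine ⟨_, red_reduce _, (alt_iff_isChain hS).1 hr.1, ?_, ?_, hr.2.trans ?_, ?_⟩
  · rw [head?_reduce]; simp [wcomp]
  · rw [getLast?_reduce]
    cases B with
    | nil => simpa [wcomp] using h2
    | cons y B =>
      change (_ ++ (B ++ [m'])).getLast? = _
      rw [← List.append_assoc, List.getLast?_concat]
  · have : 0 < Q.length := List.length_pos_iff.2 hQ0
    simp only [wcomp, List.length_append, List.length_tail, List.length_reverse,
      List.length_singleton]
    congr 1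
    omega
  · rw [← List.append_assoc]
    exact (((piEq_wcomp h1).append (.refl _)).symm.trans (piEq_wcomp h2).symm).trans
      (piEq_reduce _)

/-- Conjugating a reduced nontrivial `S`-walk by reduced walks that start with a non-`S` edge
creates no cancellation. -/
theorem red_append_middle (hS : ∀ x y, S x y → S y x) {N M t : List X} {m z m' : X}
    (hN : Red (m :: N)) (hM : Red (m' :: M))
    (hN' : ∀ x, N.head? = some x → ¬ S m x) (hM' : ∀ x, M.head? = some x → ¬ S m' x)
    (hZ : Red (m :: z :: t)) (hZc : (m :: z :: t).IsChain S)
    (hl : (m :: z :: t).getLast? = some m') : Red (N.reverse ++ (m :: z :: t) ++ M) := by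
  have hright : Red (m :: z :: t ++ M) := by
    cases M with
    | nil => simpa using hZ
    | cons n M =>
      obtain ⟨p, hp⟩ := List.getLast?_eq_some_iff.1 hl
      rw [hp] at hZ hZc ⊢
      rw [List.append_assoc]
      refine hZ.append hM fun hn => ?_
      obtain ⟨p', rfl⟩ := List.getLast?_eq_some_iff.1 hn
      have : S n m' := by
        rw [List.append_assoc] at hZc
        exact (List.isChain_cons_cons.1 (List.isChain_append.1 hZc).2.1).1
      exact hM' n rfl (hS _ _ this)
  rw [List.append_assoc]
  refine Red.append ?_ hright fun hz => ?_
  · simpa using hN.isReduced.reverse.red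
  · exact hN' z (by simpa using hz) (List.isChain_cons_cons.1 hZc).1

/-- Either every `S`-walk conjugates to an `R`-alternating walk, or at most one does, up to
equality in `π(H)`; in the latter case it and its conjugate are jointly short. -/
theorem alt_conj_dichotomy (hS : ∀ x y, S x y → S y x) (hirr : ∀ x, ¬ S x x)
    {R : X → X → Prop} (hR : ∀ x, ¬ R x x) (hSR : ∀ x y, S x y → R x y)
    {a b : List X} (ha : a ≠ []) (hb : b ≠ []) (hra : IsReduced a) (hrb : IsReduced b) :
    (∀ Q : List X, Q.IsChain S → Q.head? = a.head? → Q.getLast? = b.head? → Q.length % 2 = 1 →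
      Alt R (reduce (a.reverse ++ Q ++ b))) ∨
    ∃ P P' : List X, P.length + P'.length ≤ a.length + b.length ∧
      ∀ Q : List X, Q.IsChain S → Q.head? = a.head? → Q.getLast? = b.head? → Q.length % 2 = 1 →
        Alt R (reduce (a.reverse ++ Q ++ b)) → PiEq Q P ∧ PiEq (a.reverse ++ Q ++ b) P' := by
  obtain ⟨A, m, N, rfl, hA, hN⟩ := exists_maximal_initial_walk S ha
  obtain ⟨B, m', M, rfl, hB, hM⟩ := exists_maximal_initial_walk S hb
  have hAh : (A ++ m :: N).head? = (A ++ [m]).head? := by cases A <;> rfl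
  have hBh : (B ++ m' :: M).head? = (B ++ [m']).head? := by cases B <;> rfl
  simp only [hAh, hBh]
  have hconj : ∀ Q Z : List X, PiEq ((A ++ [m]).reverse ++ (Q ++ (B ++ [m']))) Z →
      PiEq ((A ++ m :: N).reverse ++ Q ++ (B ++ m' :: M)) (N.reverse ++ Z ++ M) := by
    intro Q Z h
    simpa using h.append_both N.reverse M
  refine or_iff_not_imp_left.2 fun hbad => ?_
  push Not at hbad
  obtain ⟨Q', hc', hh', hl', hp', hQ'⟩ := hbad
  obtain ⟨Z', -, hZc', hZh', hZl', hZp', hZe'⟩ := exists_reduced_middle hS hirr hA hB hc' hh' hl'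
  refine ⟨A ++ m :: B.reverse, N.reverse ++ m :: M, by simp; omega, ?_⟩
  intro Q hc hh hl hp hQ
  obtain ⟨Z, hZr, hZc, hZh, hZl, hZp, hZe⟩ := exists_reduced_middle hS hirr hA hB hc hh hl
  match Z, hZr, hZc, hZh, hZl, hZp, hZe with
  | [x], _, _, hZh, hZl, _, hZe =>
    obtain rfl : x = m := by simpa using hZh
    obtain rfl : x = m' := by simpa using hZl
    refine ⟨?_, by simpa using hconj _ _ hZe⟩
    have h1 := hZe.append_both (A ++ [x]) (B ++ [x]).reverse
    have h2 : PiEq ((A ++ [x]) ++ ((A ++ [x]).reverse ++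
        (Q ++ ((B ++ [x]) ++ (B ++ [x]).reverse)))) Q := by
      refine (piEq_cancel_left ?_).trans (piEq_cancel_right hl)
      rw [← hh]
      cases Q with
      | nil => cases A <;> simp at hh
      | cons => rfl
    have h3 : PiEq Q (A ++ [x] ++ [x] ++ (B ++ [x]).reverse) := by
      refine h2.symm.trans ?_
      simpa only [List.append_assoc] using h1
    refine h3.trans ((?_ : PiEq _ (A ++ x :: x :: B.reverse)).trans (piEq_loop x A _))
    simpa using piEq_loop x A (x :: B.reverse)
  | z₀ :: z :: t, hZr, hZc, hZh, hZl, hZp, hZe =>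
    exfalso
    obtain rfl : z₀ = m := by simpa using hZh
    have hred := red_append_middle hS hra.of_append_right.red hrb.of_append_right.red hN hM
      hZr hZc hZl
    rw [(hconj _ _ hZe).reduce_eq, hred.reduce_eq] at hQ
    apply hQ'
    rw [(hconj _ _ hZe').reduce_eq]
    refine (Alt.reduce hR (hQ.exchange (by simp) (fun n => ?_) (hZh'.trans hZh.symm)
      (hZl'.trans hZl.symm) (by omega))).1
    refine ((alt_iff_isChain hS).2 hZc').mono fun x y hxy => ?_
    rw [flip_iterate_eq]
    split_ifs
    exacts [hSR _ _ hxy, hSR _ _ (hS _ _ hxy)]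

end Dichotomy

section Graph

variable {V X : Type} {G : Dgraph V} {H : Dgraph X}

/-- The relation that a walk must alternate along to satisfy the zigzag condition for `v`. -/
def zigRel (G : Dgraph V) (H : Dgraph X) (v : V) (a b : X) : Prop :=
  (TypeIN G v → H.Adj b a) ∧ (TypeOUT G v → H.Adj a b)

/-- Being joined by arcs in both directions. -/
def symRel (H : Dgraph X) (a b : X) : Prop := H.Adj a b ∧ H.Adj b a

theorem symRel_symm {x y : X} (h : symRel H x y) : symRel H y x := ⟨h.2, h.1⟩

theorem symRel.zigRel {x y : X} (h : symRel H x y) (v : V) : zigRel G H v x y :=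
  ⟨fun _ => h.2, fun _ => h.1⟩

theorem zigzag_iff_alt {v : V} {l : List X} : Zigzag G H v l ↔ Alt (zigRel G H v) l := by
  simp only [Zigzag, INCompatible, OUTCompatible, alt_iff_forall, zigRel, List.get_eq_getElem]
  constructor
  · rintro ⟨h1, h2⟩ i hi
    have h1' := fun hv => h1 hv i hi
    have h2' := fun hv => h2 hv i hi
    split_ifs at * <;> exact ⟨h1', h2'⟩
  · intro h
    refine ⟨fun hv i hi => ?_, fun hv i hi => ?_⟩
    · have := h i hi
      split_ifs at * <;> exact this.1 hv
    · have := h i hi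
      split_ifs at * <;> exact this.2 hv

theorem zigRel_irrefl (hH : H.Loopless) {v : V} (hv : TypeIN G v ∨ TypeOUT G v) (x : X) :
    ¬ zigRel G H v x x := fun h => hv.elim (fun hi => hH x (h.1 hi)) fun ho => hH x (h.2 ho)

theorem zigzag_of_untyped {v : V} (hv : ¬ (TypeIN G v ∨ TypeOUT G v)) (l : List X) :
    Zigzag G H v l :=
  ⟨fun h => absurd (Or.inl h) hv, fun h => absurd (Or.inr h) hv⟩

theorem Zigzag.isChain_symRel {u : V} (hu : TypeSYM G u) {l : List X} (h : Zigzag G H u l) :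
    l.IsChain (symRel H) :=
  (alt_iff_isChain fun _ _ => symRel_symm).1
    ((zigzag_iff_alt.1 h).mono fun _ _ h => ⟨h.2 hu.2, h.1 hu.1⟩)

theorem Dgraph.UAdj.symm {a b : X} (h : H.UAdj a b) : H.UAdj b a := Or.symm h

theorem IsWalk.reverse {a b : X} {l : List X} (h : IsWalk H a b l) : IsWalk H b a l.reverse :=
  ⟨by simpa using h.1, by simpa using h.2.2.1, by simpa using h.2.1,
    List.isChain_reverse.2 (h.2.2.2.imp fun _ _ h => h.symm)⟩

theorem IsWalk.wcomp {a b c : X} {l r : List X} (hl : IsWalk H a b l) (hr : IsWalk H b c r) :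
    IsWalk H a c (wcomp l r) := by
  obtain ⟨p, rfl⟩ := List.getLast?_eq_some_iff.1 hl.2.2.1
  obtain ⟨t, rfl⟩ : ∃ t, r = b :: t := by
    have := hr.2.1
    cases r <;> simp_all
  have hc : (p ++ [b] ++ t).IsChain H.UAdj := by
    have := (List.isChain_split (c := b) (l₁ := p) (l₂ := t)).2 ⟨hl.2.2.2, hr.2.2.2⟩
    simpa using this
  refine ⟨by simp [HRecoloring.wcomp], ?_, ?_, hc⟩
  · have := hl.2.1
    cases p <;> simpa [HRecoloring.wcomp] using this
  · have := hr.2.2.1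
    simpa [HRecoloring.wcomp, List.getLast?_append, List.getLast?_cons] using this

theorem IsWalk.map {α : V → X} (hα : IsHom G H α) {a b : V} {l : List V} (h : IsWalk G a b l) :
    IsWalk H (α a) (α b) (l.map α) :=
  ⟨by simpa using h.1, by simp [h.2.1], by simp [h.2.2.1],
    (List.isChain_map α).2 (h.2.2.2.imp fun _ _ h => h.imp (@hα _ _) (@hα _ _))⟩

theorem IsWalk.reduce (hH : H.Loopless) {a b : X} {l : List X} (h : IsWalk H a b l) :
    IsWalk H a b (reduce l) ∧ (reduce l).length % 2 = l.length % 2 := by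
  have hr := Alt.reduce (R := H.UAdj) (fun x hx => hx.elim (hH x) (hH x))
    ((alt_iff_isChain fun _ _ h => h.symm).2 h.2.2.2)
  refine ⟨⟨fun h0 => ?_, by rw [head?_reduce, h.2.1], by rw [getLast?_reduce, h.2.2.1],
    (alt_iff_isChain fun _ _ h => h.symm).1 hr.1⟩, hr.2⟩
  have := head?_reduce l
  rw [h0, h.2.1] at this
  simp at this

theorem IsWalk.length_pos {a b : X} {l : List X} (h : IsWalk H a b l) : 0 < l.length :=
  List.length_pos_iff.2 h.1

theorem length_wcomp {l r : List X} (hr : 0 < r.length) :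
    (wcomp l r).length + 1 = l.length + r.length := by
  simp [wcomp]; omega

theorem IsWalk.even_wlen_iff {a b : X} {l : List X} (h : IsWalk H a b l) :
    Even (wlen l) ↔ l.length % 2 = 1 := by
  have := h.length_pos
  rw [Nat.even_iff, wlen]
  omega

variable {α β : V → X}

theorem IsWalk.conj (hα : IsHom G H α) (hβ : IsHom G H β) {q v : V} {U : List V} {Q : List X}
    (hU : IsWalk G q v U) (hQ : IsWalk H (α q) (β q) Q) :
    IsWalk H (α v) (β v) (conj α β U Q) :=
  ((hU.map hα).reverse.wcomp hQ).wcomp (hU.map hβ)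

theorem IsWalk.length_conj {q v : V} {a b : X} {U : List V} {Q : List X}
    (hU : IsWalk G q v U) (hQ : IsWalk H a b Q) :
    (HRecoloring.conj α β U Q).length + 2 = 2 * U.length + Q.length := by
  have h1 := length_wcomp (l := HRecoloring.wcomp (U.map α).reverse Q) (r := U.map β)
    (by simpa using hU.length_pos)
  have h2 := length_wcomp (l := (U.map α).reverse) hQ.length_pos
  simp only [List.length_reverse, List.length_map] at h1 h2
  rw [HRecoloring.conj]
  omega

theorem IsWalk.piEq_conj (hα : IsHom G H α) (hβ : IsHom G H β) {q v : V} {U : List V}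
    {Q : List X} (hU : IsWalk G q v U) (hQ : IsWalk H (α q) (β q) Q) :
    PiEq (HRecoloring.conj α β U Q) ((U.map α).reverse ++ Q ++ U.map β) := by
  have h1 := (hU.map hα).reverse
  refine (piEq_wcomp ?_).trans ((piEq_wcomp ?_).append (.refl _))
  · rw [(h1.wcomp hQ).2.2.1, (hU.map hβ).2.1]
  · rw [h1.2.2.1, hQ.2.1]

theorem mem_OCSet {q : V} {Uf : V → List V} {Q : List X} :
    Q ∈ OCSet G H α β q Uf ↔ IsWalk H (α q) (β q) Q ∧ IsReduced Q ∧ Even (wlen Q) ∧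
      ∀ v, Zigzag G H v (reduce (conj α β (Uf v) Q)) := by
  refine and_congr_right fun _ => and_congr_right fun _ => and_congr_right fun _ =>
    ⟨fun h v => h v _ (isReduced_reduce _) (piEq_reduce _), fun h v S hS he => ?_⟩
  rw [he.eq_reduce hS]
  exact h v

section System

variable {q₀ : V} {Wf : V → List V} (hα : IsHom G H α) (hβ : IsHom G H β)
  (hW : ∀ v, IsWalk G q₀ v (Wf v))
include hα hβ hW

theorem piEq_conj_system {u v : V} {Q : List X} (hQ : IsWalk H (α u) (β u) Q) :
    PiEq (conj α β (wcomp (Wf u).reverse (Wf v)) Q)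
      (((Wf v).map α).reverse ++ ((Wf u).map α ++ Q ++ ((Wf u).map β).reverse) ++
        (Wf v).map β) := by
  refine (((hW u).reverse.wcomp (hW v)).piEq_conj hα hβ hQ).trans ?_
  have key : ∀ {γ : V → X}, IsHom G H γ → PiEq ((wcomp (Wf u).reverse (Wf v)).map γ)
      (((Wf u).map γ).reverse ++ (Wf v).map γ) := by
    intro γ hγ
    have : (wcomp (Wf u).reverse (Wf v)).map γ = wcomp ((Wf u).map γ).reverse ((Wf v).map γ) := by
      simp [wcomp]
    rw [this]
    refine piEq_wcomp ?_
    rw [((hW u).map hγ).reverse.2.2.1, ((hW v).map hγ).2.1]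
  have := ((key hα).reverse.append (PiEq.refl Q)).append (key hβ)
  simpa using this

theorem piEq_conj_self {u : V} {Q : List X} (hQ : IsWalk H (α u) (β u) Q) :
    PiEq (conj α β (wcomp (Wf u).reverse (Wf u)) Q) Q := by
  refine (piEq_conj_system hα hβ hW hQ).trans ?_
  have h1 := piEq_cancel_left (l := ((Wf u).map α).reverse)
    (s := Q ++ (((Wf u).map β).reverse ++ (Wf u).map β))
    (by
      have := hQ.2.1
      cases Q <;> simp_all [((hW u).map hα).reverse.2.1])
  have h2 := piEq_cancel_right (l := ((Wf u).map β).reverse) (s := Q)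
    (by rw [hQ.2.2.1, ((hW u).map hβ).reverse.2.1])
  rw [List.reverse_reverse] at h1 h2
  simpa only [List.append_assoc] using h1.trans h2

theorem piEq_conj_conj {u v w : V} {Q Q' : List X} (hQ : IsWalk H (α u) (β u) Q)
    (hQ' : IsWalk H (α v) (β v) Q') (h : PiEq (conj α β (wcomp (Wf u).reverse (Wf v)) Q) Q') :
    PiEq (conj α β (wcomp (Wf v).reverse (Wf w)) Q')
      (conj α β (wcomp (Wf u).reverse (Wf w)) Q) := by
  refine (piEq_conj_system hα hβ hW hQ').trans (.trans ?_ (piEq_conj_system hα hβ hW hQ).symm)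
  refine PiEq.append_both ?_ _ _
  refine ((h.symm.trans (piEq_conj_system hα hβ hW hQ)).append_both _ _).trans ?_
  generalize hP : (Wf u).map α ++ Q ++ ((Wf u).map β).reverse = P
  have hPh : P.head? = some (α q₀) := by
    rw [← hP]
    simp [List.head?_append, (hW u).2.1]
  have hPl : P.getLast? = some (β q₀) := by
    rw [← hP]
    simp [List.getLast?_append, (hW u).2.1]
  have h1 := piEq_cancel_left (l := (Wf v).map α)
    (s := P ++ ((Wf v).map β ++ ((Wf v).map β).reverse))
    (by rw [List.head?_append, hPh, ((hW v).map hα).2.1]; rfl)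
  have h2 := piEq_cancel_right (l := (Wf v).map β) (s := P)
    (by rw [hPl, ((hW v).map hβ).2.1])
  simpa only [List.append_assoc] using h1.trans h2

theorem isWalk_reduce_conj (hH : H.Loopless) {u : V} (v : V) {Q : List X}
    (hQ : IsWalk H (α u) (β u) Q) :
    IsWalk H (α v) (β v) (reduce (conj α β (wcomp (Wf u).reverse (Wf v)) Q)) :=
  ((((hW u).reverse.wcomp (hW v)).conj hα hβ hQ).reduce hH).1

theorem reduce_conj_mem_OCSet (hH : H.Loopless) {u : V} (v : V) {Q : List X}
    (hQ : Q ∈ OCSet G H α β u fun v => wcomp (Wf u).reverse (Wf v)) :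
    reduce (conj α β (wcomp (Wf u).reverse (Wf v)) Q) ∈
      OCSet G H α β v fun w => wcomp (Wf v).reverse (Wf w) := by
  rw [mem_OCSet] at hQ ⊢
  obtain ⟨hw, -, he, hz⟩ := hQ
  have hU := (hW u).reverse.wcomp (hW v)
  have hw' := isWalk_reduce_conj hα hβ hW hH v hw
  refine ⟨hw', isReduced_reduce _, ?_, fun w => ?_⟩
  · have h1 := ((hU.conj hα hβ hw).reduce hH).2
    have h2 := hU.length_conj (α := α) (β := β) hw
    rw [hw.even_wlen_iff] at he
    rw [hw'.even_wlen_iff]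
    omega
  · rw [(piEq_conj_conj hα hβ hW hw hw' (piEq_reduce _)).reduce_eq]
    exact hz w

theorem reduce_conj_reduce_conj (hH : H.Loopless) {u v : V} {Q : List X}
    (hQ : IsWalk H (α u) (β u) Q) (hr : IsReduced Q) :
    reduce (conj α β (wcomp (Wf v).reverse (Wf u))
      (reduce (conj α β (wcomp (Wf u).reverse (Wf v)) Q))) = Q := by
  have hw' := isWalk_reduce_conj hα hβ hW hH v hQ
  exact (((piEq_conj_conj hα hβ hW hQ hw' (piEq_reduce _)).trans
    (piEq_conj_self hα hβ hW hQ)).eq_reduce hr).symm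

/-- Every orientation-compatible walk satisfies the zigzag condition for its base vertex. -/
theorem zigzag_of_mem_OCSet {q : V} {Q : List X}
    (hQ : Q ∈ OCSet G H α β q fun v => wcomp (Wf q).reverse (Wf v)) : Zigzag G H q Q :=
  hQ.2.2.2 q Q hQ.2.1 (piEq_conj_self hα hβ hW hQ.1)

end System

/-- Without vertices of type SYM, the zigzag relation flips along every edge. -/
theorem zigRel_flip_of_uadj (hG : ¬ ∃ u, TypeSYM G u) {v w : V} (h : G.UAdj v w) :
    zigRel G H w = flip (zigRel G H v) := by
  have hn : ∀ u, TypeIN G u → ¬ TypeOUT G u := fun u hi ho => hG ⟨u, hi, ho⟩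
  funext a b
  rcases h with h | h
  · have h1 : TypeOUT G v := ⟨w, h⟩
    have h2 : TypeIN G w := ⟨v, h⟩
    have h3 : ¬ TypeIN G v := fun h => hn v h h1
    simp [zigRel, flip, h1, h2, h3, hn w h2]
  · have h1 : TypeIN G v := ⟨w, h⟩
    have h2 : TypeOUT G w := ⟨v, h⟩
    have h3 : ¬ TypeIN G w := fun h => hn w h h2
    simp [zigRel, flip, h1, h2, h3, hn v h1]

theorem IsWalk.alt_map (hG : ¬ ∃ u, TypeSYM G u) (hα : IsHom G H α) {v q : V} {L : List V}
    (hL : IsWalk G v q L) :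
    Alt (zigRel G H v) (L.map α) ∧ flip^[wlen L] (zigRel G H v) = zigRel G H q := by
  induction L generalizing v with
  | nil => exact absurd rfl hL.1
  | cons x L ih =>
    obtain ⟨-, h1, h2, h3⟩ := hL
    obtain rfl : x = v := by simpa using h1
    cases L with
    | nil =>
      obtain rfl : x = q := by simpa using h2
      exact ⟨trivial, rfl⟩
    | cons y t =>
      replace h3 := List.isChain_cons_cons.1 h3
      obtain ⟨i1, i2⟩ := ih (v := y) ⟨by simp, rfl, by simpa using h2, h3.2⟩
      rw [zigRel_flip_of_uadj hG h3.1] at i1 i2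
      refine ⟨⟨?_, i1⟩, i2⟩
      have hn : ∀ u, TypeIN G u → ¬ TypeOUT G u := fun u hi ho => hG ⟨u, hi, ho⟩
      rcases h3.1 with h | h
      · exact ⟨fun hi => absurd ⟨y, h⟩ (hn x hi), fun _ => hα h⟩
      · exact ⟨fun _ => hα h, fun ho => absurd ho (hn x ⟨y, h⟩)⟩

theorem zigzag_reduce_conj_of_no_sym (hG : ¬ ∃ u, TypeSYM G u) (hH : H.Loopless)
    (hα : IsHom G H α) (hβ : IsHom G H β) {q v : V} {U : List V} (hU : IsWalk G q v U)
    {Q : List X} (hQ : IsWalk H (α q) (β q) Q) (he : Even (wlen Q)) (hz : Zigzag G H q Q) :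
    Zigzag G H v (reduce (conj α β U Q)) := by
  by_cases hv : TypeIN G v ∨ TypeOUT G v
  swap
  · exact zigzag_of_untyped hv _
  rw [zigzag_iff_alt] at hz ⊢
  refine (Alt.reduce (zigRel_irrefl hH hv) ?_).1
  obtain ⟨h1, h2⟩ := hU.reverse.alt_map hG hα
  have hUα := (hU.map hα).reverse
  have hlen : wlen (U.map α).reverse = wlen U.reverse := by simp [wlen]
  refine alt_wcomp (alt_wcomp ?_ ?_ ?_) ?_ ?_
  · simpa using h1
  · rwa [hlen, h2]
  · rw [hUα.2.2.1, hQ.2.1]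
  · have h3 : wlen (wcomp (U.map α).reverse Q) = wlen Q + wlen U.reverse := by
      have := length_wcomp (l := (U.map α).reverse) hQ.length_pos
      have := hU.length_pos
      have := hQ.length_pos
      simp only [wlen, List.length_reverse, List.length_map] at *
      omega
    rw [h3, Function.iterate_add_apply, h2, flip_iterate_eq, if_pos (Nat.even_iff.1 he)]
    exact (hU.alt_map hG hβ).1
  · rw [(hUα.wcomp hQ).2.2.1, (hU.map hβ).2.1]

/-- For a vertex `u` of type SYM and any walk `U` from `u` to `v`: either every candidate at `u`
generates a walk satisfying the zigzag condition for `v`, or at most one does, and then it and the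
generated walk are jointly short. -/
theorem zigzag_conj_dichotomy (hH : H.Loopless) (hα : IsHom G H α) (hβ : IsHom G H β) {u v : V}
    (hu : TypeSYM G u) {U : List V} (hU : IsWalk G u v U) :
    (∀ Q, IsWalk H (α u) (β u) Q → Even (wlen Q) → Zigzag G H u Q →
      Zigzag G H v (reduce (conj α β U Q))) ∨
    ∃ P, ∀ Q, IsWalk H (α u) (β u) Q → IsReduced Q → Even (wlen Q) → Zigzag G H u Q →
      Zigzag G H v (reduce (conj α β U Q)) →
      Q = P ∧ wlen Q + wlen (reduce (conj α β U Q)) ≤ 2 * wlen U := by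
  by_cases hv : TypeIN G v ∨ TypeOUT G v
  swap
  · exact Or.inl fun _ _ _ _ => zigzag_of_untyped hv _
  have ha := ((hU.map hα).reduce hH).1
  have hb := ((hU.map hβ).reduce hH).1
  have hred : ∀ Q, IsWalk H (α u) (β u) Q → PiEq (conj α β U Q)
      ((reduce (U.map α)).reverse ++ Q ++ reduce (U.map β)) := fun Q hQ =>
    (hU.piEq_conj hα hβ hQ).trans
      (((piEq_reduce _).reverse.append (.refl _)).append (piEq_reduce _))
  rcases alt_conj_dichotomy (S := symRel H) (fun _ _ => symRel_symm) (fun x h => hH x h.1)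
    (zigRel_irrefl (G := G) hH hv) (fun _ _ h => h.zigRel v) ha.1 hb.1 (isReduced_reduce _)
    (isReduced_reduce _) with h | ⟨P, P', hlen, h⟩
  · refine Or.inl fun Q hQ he hz => ?_
    rw [zigzag_iff_alt, (hred Q hQ).reduce_eq]
    exact h Q (hz.isChain_symRel hu) (hQ.2.1.trans ha.2.1.symm) (hQ.2.2.1.trans hb.2.1.symm)
      (hQ.even_wlen_iff.1 he)
  · refine Or.inr ⟨reduce P, fun Q hQ hr he hz hz' => ?_⟩
    rw [zigzag_iff_alt, (hred Q hQ).reduce_eq] at hz'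
    obtain ⟨h1, h2⟩ := h Q (hz.isChain_symRel hu) (hQ.2.1.trans ha.2.1.symm)
      (hQ.2.2.1.trans hb.2.1.symm) (hQ.even_wlen_iff.1 he) hz'
    have hQP := h1.symm.eq_reduce hr
    refine ⟨hQP, ?_⟩
    rw [((hred Q hQ).trans h2).reduce_eq]
    have e1 := length_reduce_le P
    rw [← hQP] at e1
    have e2 := length_reduce_le P'
    have e3 := length_reduce_le (U.map α)
    have e4 := length_reduce_le (U.map β)
    have e5 := hQ.length_pos
    have e6 : 0 < (reduce P').length := by
      rw [← ((hred Q hQ).trans h2).reduce_eq]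
      exact ((hU.conj hα hβ hQ).reduce hH).1.length_pos
    simp only [List.length_map] at e3 e4
    unfold wlen
    omega

end Graph

end HRecoloring

/-- There is a vertex `q` such that the set of orientation-compatible walks
for `q` and the system `(W_q⁻¹ W_v)` is empty, a single reduced even walk of
length at most `2|V(G)|`, or the set of all reduced even-length walks from
`α q` to `β q` satisfying the zigzag condition for `q`. -/
theorem statement9 {V X : Type} [Fintype V] [Fintype X]
    (G : Dgraph V) (H : Dgraph X)
    (hGll : G.Loopless) (hHll : H.Loopless)
    (hGconn : G.WConn) (hHconn : H.WConn)
    (α β : V → X) (hα : IsHom G H α) (hβ : IsHom G H β)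
    (q₀ : V) (Wf : V → List V)
    (hWf : ∀ v, IsWalk G q₀ v (Wf v) ∧ wlen (Wf v) ≤ Fintype.card V) :
    ∃ q : V,
      OCSet G H α β q (fun v => wcomp (Wf q).reverse (Wf v)) = ∅ ∨
      (∃ Q : List X,
        OCSet G H α β q (fun v => wcomp (Wf q).reverse (Wf v)) = {Q} ∧
        wlen Q ≤ 2 * Fintype.card V) ∨
      OCSet G H α β q (fun v => wcomp (Wf q).reverse (Wf v)) =
        {Q | IsWalk H (α q) (β q) Q ∧ IsReduced Q ∧ Even (wlen Q) ∧
          Zigzag G H q Q} := by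
  have hW := fun v => (hWf v).1
  by_cases hG : ∃ u, TypeSYM G u
  swap
  · refine ⟨q₀, Or.inr (Or.inr (Set.ext fun Q => ⟨fun hQ => ?_, fun hQ => ?_⟩))⟩
    · exact ⟨hQ.1, hQ.2.1, hQ.2.2.1, zigzag_of_mem_OCSet hα hβ hW hQ⟩
    · exact mem_OCSet.2 ⟨hQ.1, hQ.2.1, hQ.2.2.1, fun v => zigzag_reduce_conj_of_no_sym hG hHll
        hα hβ ((hW q₀).reverse.wcomp (hW v)) hQ.1 hQ.2.2.1 hQ.2.2.2⟩
  obtain ⟨u, hu⟩ := hG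
  by_cases hall : ∀ v Q, IsWalk H (α u) (β u) Q → Even (wlen Q) → Zigzag G H u Q →
      Zigzag G H v (reduce (conj α β (wcomp (Wf u).reverse (Wf v)) Q))
  · refine ⟨u, Or.inr (Or.inr (Set.ext fun Q => ⟨fun hQ => ?_, fun hQ => ?_⟩))⟩
    · exact ⟨hQ.1, hQ.2.1, hQ.2.2.1, zigzag_of_mem_OCSet hα hβ hW hQ⟩
    · exact mem_OCSet.2 ⟨hQ.1, hQ.2.1, hQ.2.2.1, fun v => hall v Q hQ.1 hQ.2.2.1 hQ.2.2.2⟩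
  push Not at hall
  obtain ⟨v, Q₁, hw₁, he₁, hz₁, hn₁⟩ := hall
  obtain ⟨P, hP⟩ := (zigzag_conj_dichotomy hHll hα hβ hu
    ((hW u).reverse.wcomp (hW v))).resolve_left fun h => hn₁ (h Q₁ hw₁ he₁ hz₁)
  rcases (OCSet G H α β u fun v => wcomp (Wf u).reverse (Wf v)).eq_empty_or_nonempty with
    hemp | ⟨Q, hQ⟩
  · exact ⟨u, Or.inl hemp⟩
  have hP' := fun R (hR : R ∈ OCSet G H α β u fun v => wcomp (Wf u).reverse (Wf v)) =>
    hP R hR.1 hR.2.1 hR.2.2.1 (zigzag_of_mem_OCSet hα hβ hW hR) ((mem_OCSet.1 hR).2.2.2 v)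
  obtain ⟨hQP, hlen⟩ := hP' Q hQ
  have hU : wlen (wcomp (Wf u).reverse (Wf v)) ≤ 2 * Fintype.card V := by
    have h1 := length_wcomp (l := (Wf u).reverse) (hW v).length_pos
    have h2 := (hWf u).2
    have h3 := (hWf v).2
    simp only [wlen, List.length_reverse] at *
    omega
  by_cases hshort : wlen Q ≤ 2 * Fintype.card V
  · refine ⟨u, Or.inr (Or.inl ⟨Q, Set.eq_singleton_iff_unique_mem.2 ⟨hQ, fun R hR => ?_⟩,
      hshort⟩)⟩
    rw [hQP, (hP' R hR).1]
  · refine ⟨v, Or.inr (Or.inl ⟨_, Set.eq_singleton_iff_unique_mem.2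
      ⟨reduce_conj_mem_OCSet hα hβ hW hHll v hQ, fun R hR => ?_⟩, by omega⟩)⟩
    have hR' := reduce_conj_mem_OCSet hα hβ hW hHll u hR
    rw [hQP, ← (hP' _ hR').1]
    exact (reduce_conj_reduce_conj hα hβ hW hHll hR.1 hR.2.1).symm
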